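/- arXiv:1407.0676 — 4 statements merged into one kernel-verified Lean document; each statement's English description precedes it below -/
import Mathlib

section
/- Let (X,d_X) and (Y,d_Y) be metric spaces and endow X×Y with a metric d satisfying m₁ max(d_X,d_Y) ≤ d ≤ m₂ max(d_X,d_Y) for some constants 0 < m₁ ≤ m₂. Then for all subsets F ⊂ X and G ⊂ Y, all points (x,y) ∈ F×G, and all δ, ρ > 0: N(B_δ((x,y)) ∩ (F×G), ρ) ≤ N(B_{δ/m₁}(x) ∩ F, ρ/m₂) · N(B_{δ/m₁}(y) ∩ G, ρ/m₂), and N(B_δ((x,y)) ∩ (F×G), ρ) ≥ N(B_{δ/m₂}(x) ∩ F, 4ρ/m₁) · N(B_{δ/m₂}(y) ∩ G, 4ρ/m₁). -/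
open Metric Set Filter
open scoped ENNReal NNReal

namespace Paper

noncomputable def coverNum {X : Type*} [MetricSpace X] (F : Set X) (r : ℝ) : ℝ≥0∞ :=
  ⨅ (s : Finset X) (_ : F ⊆ ⋃ x ∈ s, closedBall x r), (s.card : ℝ≥0∞)

noncomputable def diamCoverNum {X : Type*} [MetricSpace X] (F : Set X) (r : ℝ) : ℝ≥0∞ :=
  ⨅ (U : Finset (Set X)) (_ : F ⊆ ⋃₀ ↑U)
    (_ : ∀ A ∈ U, EMetric.diam A ≤ ENNReal.ofReal r), (U.card : ℝ≥0∞)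

noncomputable def lowerBoxDim {X : Type*} [MetricSpace X] (F : Set X) : ℝ :=
  Filter.liminf (fun r : ℝ => Real.log (coverNum F r).toReal / (-Real.log r))
    (nhdsWithin 0 (Set.Ioi 0))

noncomputable def upperBoxDim {X : Type*} [MetricSpace X] (F : Set X) : ℝ :=
  Filter.limsup (fun r : ℝ => Real.log (coverNum F r).toReal / (-Real.log r))
    (nhdsWithin 0 (Set.Ioi 0))

def IsHomogeneous {X : Type*} [MetricSpace X] (F : Set X) (s : ℝ) : Prop :=
  ∀ δ₀ : ℝ, 0 < δ₀ → ∃ C : ℝ, 0 < C ∧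
    ∀ x ∈ F, ∀ δ ρ : ℝ, 0 < ρ → ρ < δ → δ ≤ δ₀ →
      coverNum (closedBall x δ ∩ F) ρ ≤ ENNReal.ofReal (C * (δ / ρ) ^ s)

noncomputable def assouadDim {X : Type*} [MetricSpace X] (F : Set X) : EReal :=
  sInf ((fun s : ℝ => (s : EReal)) '' {s : ℝ | 0 ≤ s ∧ IsHomogeneous F s})

def EquiHomogeneous {X : Type*} [MetricSpace X] (F : Set X) : Prop :=
  ∀ δ₀ : ℝ, 0 < δ₀ → ∃ M : ℝ≥0, 1 ≤ M ∧ ∃ c₁ c₂ : ℝ, 0 < c₁ ∧ 0 < c₂ ∧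
    ∀ δ ρ : ℝ, 0 < ρ → ρ < δ → δ ≤ δ₀ →
      (⨆ x ∈ F, coverNum (closedBall x δ ∩ F) ρ) ≤
        (M : ℝ≥0∞) * ⨅ x ∈ F, coverNum (closedBall x (c₁ * δ) ∩ F) (c₂ * ρ)

noncomputable def cantorLen (lam : ℕ → ℝ) (n : ℕ) : ℝ := ∏ i ∈ Finset.range n, lam i

noncomputable def cantorPre (lam : ℕ → ℝ) (n : ℕ) : Set ℝ :=
  ⋃ ε : ℕ → Bool,
    Set.Icc (∑ i ∈ Finset.range n, if ε i then cantorLen lam i - cantorLen lam (i + 1) else 0)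
      ((∑ i ∈ Finset.range n, if ε i then cantorLen lam i - cantorLen lam (i + 1) else 0) +
        cantorLen lam n)

noncomputable def cantorSet (lam : ℕ → ℝ) : Set ℝ := ⋂ n : ℕ, cantorPre lam n

open Classical in
noncomputable def lamSeq (q : ℝ) (a : ℕ → ℕ) (i : ℕ) : ℝ :=
  if h : ∃ k : ℕ, i + 1 = ∑ j ∈ Finset.range (k + 1), a (2 * j) then
    q ^ (a (2 * h.choose + 1) + 1)
  else q

open Classical in
noncomputable def muSeq (q : ℝ) (a : ℕ → ℕ) (i : ℕ) : ℝ :=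
  if h : ∃ k : ℕ, i + 1 = a 0 + ∑ j ∈ Finset.range (k + 1), a (2 * j + 1) then
    q ^ (a (2 * h.choose + 2) + 1)
  else q

noncomputable def prodSetL2 (C D : Set ℝ) : Set (WithLp 2 (ℝ × ℝ)) :=
  (WithLp.equiv 2 (ℝ × ℝ)).symm '' (C ×ˢ D)

section Covering

variable {X Y Z : Type*} [MetricSpace X] [MetricSpace Y] [MetricSpace Z]

theorem coverNum_le_card {F : Set X} {r : ℝ} (s : Finset X)
    (hs : F ⊆ ⋃ x ∈ s, closedBall x r) : coverNum F r ≤ (s.card : ℝ≥0∞) :=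
  iInf₂_le s hs

theorem coverNum_ne_zero {F : Set X} {r : ℝ} (hF : F.Nonempty) : coverNum F r ≠ 0 := by
  obtain ⟨x, hx⟩ := hF
  refine (lt_of_lt_of_le zero_lt_one (le_iInf₂ fun s hs => ?_)).ne'
  obtain ⟨c, hc, -⟩ := mem_iUnion₂.1 (hs hx)
  exact_mod_cast Finset.card_pos.2 ⟨c, hc⟩

/-- A finite covering number is attained by some finite cover. -/
theorem coverNum_eq_top_or_exists (F : Set X) (r : ℝ) :
    coverNum F r = ⊤ ∨
      ∃ s : Finset X, F ⊆ ⋃ x ∈ s, closedBall x r ∧ coverNum F r = (s.card : ℝ≥0∞) := by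
  classical
  by_cases h : ∃ n : ℕ, ∃ s : Finset X, s.card = n ∧ F ⊆ ⋃ x ∈ s, closedBall x r
  · right
    obtain ⟨s, hcard, hs⟩ := Nat.find_spec h
    refine ⟨s, hs, le_antisymm (coverNum_le_card s hs) (le_iInf₂ fun t ht => ?_)⟩
    rw [hcard]
    exact_mod_cast Nat.find_min' h ⟨t, rfl, ht⟩
  · left
    exact iInf₂_eq_top.2 fun s hs => absurd ⟨_, s, rfl, hs⟩ h

theorem exists_nat_ge_of_lt_coverNum {F : Set X} {r : ℝ} {a : ℝ≥0∞}
    (ha : a < coverNum F r) : ∃ n : ℕ, a ≤ n ∧ (n : ℝ≥0∞) ≤ coverNum F r := by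
  rcases coverNum_eq_top_or_exists F r with h | ⟨s, -, hs⟩
  · obtain ⟨n, hn⟩ := ENNReal.exists_nat_gt (ne_top_of_lt ha)
    exact ⟨n, hn.le, h ▸ le_top⟩
  · exact ⟨s.card, hs ▸ ha.le, hs.ge⟩

/-- A set whose `r`-covering number is at least `n` contains `n` points at pairwise distances
greater than `r`. -/
theorem exists_separated_of_le_coverNum {F : Set X} {r : ℝ} {n : ℕ} (hr : 0 ≤ r)
    (hn : (n : ℝ≥0∞) ≤ coverNum F r) :
    ∃ s : Finset X, s.card = n ∧ ↑s ⊆ F ∧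
      (s : Set X).Pairwise fun x y => r < dist x y := by
  classical
  induction n with
  | zero => exact ⟨∅, by simp⟩
  | succ n ih =>
    have hlt : (n : ℝ≥0∞) < coverNum F r := lt_of_lt_of_le (by exact_mod_cast n.lt_succ_self) hn
    obtain ⟨s, hcard, hsF, hs⟩ := ih hlt.le
    have hcover : ¬ F ⊆ ⋃ x ∈ s, closedBall x r := fun h =>
      (coverNum_le_card s h).not_gt (hcard ▸ hlt)
    obtain ⟨x, hxF, hx⟩ := not_subset.1 hcover
    simp only [mem_iUnion, mem_closedBall, not_exists, not_le] at hx
    have hxs : x ∉ s := fun h => by linarith [hx x h, dist_self x]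
    refine ⟨insert x s, by rw [Finset.card_insert_of_notMem hxs, hcard], ?_, ?_⟩
    · rw [Finset.coe_insert]
      exact insert_subset hxF hsF
    · rw [Finset.coe_insert]
      exact hs.insert fun y hy _ => ⟨hx y hy, dist_comm x y ▸ hx y hy⟩

/-- Points at pairwise distances greater than `2 * r` lie in distinct balls of radius `r`. -/
theorem card_le_coverNum_of_separated {F : Set X} {r : ℝ} {s : Finset X} (hsF : ↑s ⊆ F)
    (hs : (s : Set X).Pairwise fun x y => 2 * r < dist x y) :
    (s.card : ℝ≥0∞) ≤ coverNum F r := by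
  refine le_iInf₂ fun t ht => ?_
  have h : ∀ x ∈ s, ∃ c ∈ t, dist x c ≤ r := fun x hx => by
    simpa only [mem_iUnion, exists_prop, mem_closedBall] using ht (hsF hx)
  choose! c hct hc using h
  refine Nat.cast_le.2 (Finset.card_le_card_of_injOn c hct fun x hx y hy hxy => ?_)
  by_contra hne
  have hyc := hc y hy
  rw [← hxy] at hyc
  linarith [hs hx hy hne, hc x hx, dist_triangle_right x y (c x)]

theorem coverNum_le_mul_of_dist_le {A : Set X} {B : Set Y} {S : Set Z} {r ρ : ℝ} (f : X × Y → Z)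
    (hA : A.Nonempty) (hB : B.Nonempty) (hS : S ⊆ f '' A ×ˢ B)
    (hf : ∀ p q : X × Y, dist p.1 q.1 ≤ r → dist p.2 q.2 ≤ r → dist (f p) (f q) ≤ ρ) :
    coverNum S ρ ≤ coverNum A r * coverNum B r := by
  classical
  rcases coverNum_eq_top_or_exists A r with h | ⟨s, hs, hcs⟩
  · simp [h, ENNReal.top_mul (coverNum_ne_zero hB)]
  rcases coverNum_eq_top_or_exists B r with h | ⟨t, ht, hct⟩
  · simp [h, ENNReal.mul_top (coverNum_ne_zero hA)]
  rw [hcs, hct, ← Nat.cast_mul, ← Finset.card_product]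
  refine (coverNum_le_card ((s ×ˢ t).image f) fun z hz => ?_).trans
    (Nat.cast_le.2 Finset.card_image_le)
  obtain ⟨p, ⟨hpA, hpB⟩, rfl⟩ := hS hz
  obtain ⟨a, ha, hpa⟩ := mem_iUnion₂.1 (hs hpA)
  obtain ⟨b, hb, hpb⟩ := mem_iUnion₂.1 (ht hpB)
  exact mem_iUnion₂.2 ⟨f (a, b), Finset.mem_image_of_mem f (Finset.mk_mem_product ha hb),
    hf p (a, b) hpa hpb⟩

theorem mul_coverNum_le_of_dist_le {A : Set X} {B : Set Y} {S : Set Z} {r ρ : ℝ} (f : X × Y → Z)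
    (hr : 0 ≤ r) (hρ : 0 ≤ ρ) (hS : f '' A ×ˢ B ⊆ S)
    (hf : ∀ p q : X × Y, dist (f p) (f q) ≤ 2 * ρ → dist p.1 q.1 ≤ r ∧ dist p.2 q.2 ≤ r) :
    coverNum A r * coverNum B r ≤ coverNum S ρ := by
  classical
  have key : ∀ n m : ℕ, (n : ℝ≥0∞) ≤ coverNum A r → (m : ℝ≥0∞) ≤ coverNum B r →
      (n : ℝ≥0∞) * m ≤ coverNum S ρ := by
    intro n m hn hm
    obtain ⟨s, rfl, hsA, hs⟩ := exists_separated_of_le_coverNum hr hn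
    obtain ⟨t, rfl, htB, ht⟩ := exists_separated_of_le_coverNum hr hm
    have hsep : ∀ p ∈ s ×ˢ t, ∀ q ∈ s ×ˢ t, p ≠ q → 2 * ρ < dist (f p) (f q) := by
      intro p hp q hq hne
      rw [Finset.mem_product] at hp hq
      by_contra! hle
      obtain ⟨h₁, h₂⟩ := hf p q hle
      refine hne (Prod.ext ?_ ?_)
      · by_contra hne₁
        exact (hs hp.1 hq.1 hne₁).not_ge h₁
      · by_contra hne₂
        exact (ht hp.2 hq.2 hne₂).not_ge h₂
    have hinj : Set.InjOn f ↑(s ×ˢ t) := fun p hp q hq hpq => by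
      by_contra hne
      have := hsep p hp q hq hne
      rw [hpq, dist_self] at this
      linarith
    rw [← Nat.cast_mul, ← Finset.card_product, ← Finset.card_image_of_injOn hinj]
    refine card_le_coverNum_of_separated ?_ ?_
    · rw [Finset.coe_image, Finset.coe_product]
      exact (image_mono (prod_mono hsA htB)).trans hS
    · rw [Finset.coe_image]
      rintro _ ⟨p, hp, rfl⟩ _ ⟨q, hq, rfl⟩ hne
      exact hsep p hp q hq fun h => hne (congrArg f h)
  refine ENNReal.mul_le_of_forall_lt fun a ha b hb => ?_
  obtain ⟨n, han, hn⟩ := exists_nat_ge_of_lt_coverNum ha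
  obtain ⟨m, hbm, hm⟩ := exists_nat_ge_of_lt_coverNum hb
  exact (mul_le_mul' han hbm).trans (key n m hn hm)

end Covering

theorem statement0 {X Y : Type*} [MetricSpace X] [MetricSpace Y]
    (dZ : MetricSpace (X × Y)) (m₁ m₂ : ℝ) (hm₁ : 0 < m₁) (hm : m₁ ≤ m₂)
    (hd₁ : ∀ p q : X × Y,
      m₁ * max (dist p.1 q.1) (dist p.2 q.2) ≤ @dist _ dZ.toPseudoMetricSpace.toDist p q)
    (hd₂ : ∀ p q : X × Y,
      @dist _ dZ.toPseudoMetricSpace.toDist p q ≤ m₂ * max (dist p.1 q.1) (dist p.2 q.2))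
    (F : Set X) (G : Set Y) (x : X) (y : Y) (hx : x ∈ F) (hy : y ∈ G)
    (δ ρ : ℝ) (hδ : 0 < δ) (hρ : 0 < ρ) :
    @coverNum _ dZ (@closedBall _ dZ.toPseudoMetricSpace (x, y) δ ∩ F ×ˢ G) ρ ≤
        coverNum (closedBall x (δ / m₁) ∩ F) (ρ / m₂) *
          coverNum (closedBall y (δ / m₁) ∩ G) (ρ / m₂) ∧
      coverNum (closedBall x (δ / m₂) ∩ F) (4 * ρ / m₁) *
          coverNum (closedBall y (δ / m₂) ∩ G) (4 * ρ / m₁) ≤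
        @coverNum _ dZ (@closedBall _ dZ.toPseudoMetricSpace (x, y) δ ∩ F ×ˢ G) ρ := by
  have hm₂ : 0 < m₂ := hm₁.trans_le hm
  constructor
  · refine @coverNum_le_mul_of_dist_le X Y (X × Y) _ _ dZ _ _ _ _ _ id
      ⟨x, mem_closedBall_self (by positivity), hx⟩ ⟨y, mem_closedBall_self (by positivity), hy⟩
      ?_ ?_
    · rintro p ⟨hp, hpF, hpG⟩
      have h : max (dist p.1 x) (dist p.2 y) ≤ δ / m₁ := by
        rw [le_div_iff₀' hm₁]
        exact (hd₁ p (x, y)).trans hp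
      exact ⟨p, ⟨⟨(le_max_left _ _).trans h, hpF⟩, (le_max_right _ _).trans h, hpG⟩, rfl⟩
    · intro p q h₁ h₂
      exact (hd₂ p q).trans ((le_div_iff₀' hm₂).1 (max_le h₁ h₂))
  · refine @mul_coverNum_le_of_dist_le X Y (X × Y) _ _ dZ _ _ _ _ _ id (by positivity) hρ.le
      ?_ ?_
    · rintro _ ⟨p, ⟨⟨hpx, hpF⟩, hpy, hpG⟩, rfl⟩
      exact ⟨(hd₂ p (x, y)).trans ((le_div_iff₀' hm₂).1 (max_le hpx hpy)), hpF, hpG⟩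
    · intro p q h
      refine max_le_iff.1 ((le_div_iff₀' hm₁).2 ?_)
      exact (hd₁ p q).trans (h.trans (by linarith))

end Paper
end

section
/- Let (X,d_X) and (Y,d_Y) be metric spaces and endow X×Y with a metric d satisfying m₁ max(d_X,d_Y) ≤ d ≤ m₂ max(d_X,d_Y) for some constants 0 < m₁ ≤ m₂. Then for all F ⊂ X and G ⊂ Y, dim_A(F×G) ≤ dim_A F + dim_A G. In particular, if F is s-homogeneous and G is t-homogeneous then F×G is (s+t)-homogeneous. -/
open Metric Set Filter
open scoped ENNReal NNReal

namespace Paper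

theorem coverNum_le_of_subset {X : Type*} [MetricSpace X] {F : Set X} {r : ℝ} {s : Finset X}
    (hs : F ⊆ ⋃ x ∈ s, closedBall x r) : coverNum F r ≤ s.card :=
  iInf₂_le s hs

theorem exists_finset_of_coverNum_le {X : Type*} [MetricSpace X] {F : Set X} {r c : ℝ}
    (hc : 0 ≤ c) (h : coverNum F r ≤ ENNReal.ofReal c) :
    ∃ s : Finset X, F ⊆ ⋃ x ∈ s, closedBall x r ∧ (s.card : ℝ) ≤ c := by
  have hlt : coverNum F r < ((⌊c⌋₊ + 1 : ℕ) : ℝ≥0∞) := by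
    refine h.trans_lt ?_
    rw [← ENNReal.ofReal_natCast, ENNReal.ofReal_lt_ofReal_iff (by positivity)]
    exact_mod_cast Nat.lt_floor_add_one c
  obtain ⟨s, hs⟩ := iInf_lt_iff.1 hlt
  obtain ⟨hcover, hcard⟩ := iInf_lt_iff.1 hs
  refine ⟨s, hcover, ?_⟩
  have hle : s.card ≤ ⌊c⌋₊ := Nat.lt_succ_iff.1 (by exact_mod_cast hcard)
  exact (Nat.cast_le.2 hle).trans (Nat.floor_le hc)

theorem subset_iUnion_closedBall_image2 {X Y Z : Type*} [MetricSpace X] [MetricSpace Y]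
    [MetricSpace Z] [DecidableEq Z] {f : X → Y → Z} {m r : ℝ} (hm : 0 < m)
    (hf : ∀ x x' y y', dist (f x y) (f x' y') ≤ m * max (dist x x') (dist y y'))
    {A : Set X} {B : Set Y} {s : Finset X} {t : Finset Y}
    (hs : A ⊆ ⋃ x ∈ s, closedBall x (r / m)) (ht : B ⊆ ⋃ y ∈ t, closedBall y (r / m)) :
    image2 f A B ⊆ ⋃ z ∈ Finset.image₂ f s t, closedBall z r := by
  rintro _ ⟨x, hx, y, hy, rfl⟩
  obtain ⟨a, ha, hxa⟩ := mem_iUnion₂.1 (hs hx)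
  obtain ⟨b, hb, hyb⟩ := mem_iUnion₂.1 (ht hy)
  refine mem_iUnion₂.2 ⟨f a b, Finset.mem_image₂_of_mem ha hb, ?_⟩
  exact (hf x a y b).trans ((le_div_iff₀' hm).1 (max_le hxa hyb))

theorem closedBall_inter_image2_subset {X Y Z : Type*} [MetricSpace X] [MetricSpace Y]
    [MetricSpace Z] {f : X → Y → Z} {m : ℝ} (hm : 0 < m)
    (hf : ∀ x x' y y', m * max (dist x x') (dist y y') ≤ dist (f x y) (f x' y'))
    (F : Set X) (G : Set Y) (x : X) (y : Y) (r : ℝ) :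
    closedBall (f x y) r ∩ image2 f F G ⊆
      image2 f (closedBall x (r / m) ∩ F) (closedBall y (r / m) ∩ G) := by
  rintro _ ⟨hz, a, ha, b, hb, rfl⟩
  have h := max_le_iff.1 ((le_div_iff₀' hm).2 ((hf a x b y).trans hz))
  exact ⟨a, ⟨h.1, ha⟩, b, ⟨h.2, hb⟩, rfl⟩

theorem IsHomogeneous.image2 {X Y Z : Type*} [MetricSpace X] [MetricSpace Y] [MetricSpace Z]
    {f : X → Y → Z} {m₁ m₂ : ℝ} (hm₁ : 0 < m₁) (hm : m₁ ≤ m₂)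
    (hf₁ : ∀ x x' y y', m₁ * max (dist x x') (dist y y') ≤ dist (f x y) (f x' y'))
    (hf₂ : ∀ x x' y y', dist (f x y) (f x' y') ≤ m₂ * max (dist x x') (dist y y'))
    {F : Set X} {G : Set Y} {s t : ℝ} (hF : IsHomogeneous F s) (hG : IsHomogeneous G t) :
    IsHomogeneous (image2 f F G) (s + t) := by
  classical
  intro δ₀ hδ₀
  have hm₂ : 0 < m₂ := hm₁.trans_le hm
  obtain ⟨C, hC, hCF⟩ := hF (δ₀ / m₁) (by positivity)
  obtain ⟨D, hD, hDG⟩ := hG (δ₀ / m₁) (by positivity)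
  refine ⟨C * D * (m₂ / m₁) ^ (s + t), by positivity, ?_⟩
  rintro _ ⟨x, hx, y, hy, rfl⟩ δ ρ hρ hρδ hδ
  have hδpos : 0 < δ := hρ.trans hρδ
  have hlt : ρ / m₂ < δ / m₁ := (div_le_div_of_nonneg_left hρ.le hm₁ hm).trans_lt (by gcongr)
  have hle : δ / m₁ ≤ δ₀ / m₁ := by gcongr
  obtain ⟨u, hu, hu_card⟩ := exists_finset_of_coverNum_le (by positivity)
    (hCF x hx (δ / m₁) (ρ / m₂) (by positivity) hlt hle)
  obtain ⟨v, hv, hv_card⟩ := exists_finset_of_coverNum_le (by positivity)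
    (hDG y hy (δ / m₁) (ρ / m₂) (by positivity) hlt hle)
  have hcover := (closedBall_inter_image2_subset hm₁ hf₁ F G x y δ).trans
    (subset_iUnion_closedBall_image2 hm₂ hf₂ hu hv)
  refine (coverNum_le_of_subset hcover).trans ?_
  rw [← ENNReal.ofReal_natCast]
  refine ENNReal.ofReal_le_ofReal ?_
  calc ((Finset.image₂ f u v).card : ℝ) ≤ u.card * v.card := by
        exact_mod_cast Finset.card_image₂_le f u v
    _ ≤ (C * (δ / m₁ / (ρ / m₂)) ^ s) * (D * (δ / m₁ / (ρ / m₂)) ^ t) := by gcongr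
    _ = C * D * (δ / m₁ / (ρ / m₂)) ^ (s + t) := by
        rw [Real.rpow_add (by positivity)]; ring
    _ = C * D * (m₂ / m₁ * (δ / ρ)) ^ (s + t) := by
        congr 2; field_simp
    _ = C * D * (m₂ / m₁) ^ (s + t) * (δ / ρ) ^ (s + t) := by
        rw [Real.mul_rpow (by positivity) (by positivity)]; ring

theorem assouadDim_nonneg {X : Type*} [MetricSpace X] (F : Set X) : 0 ≤ assouadDim F := by
  refine le_sInf ?_
  rintro _ ⟨s, ⟨hs, -⟩, rfl⟩
  exact EReal.coe_nonneg.2 hs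

theorem assouadDim_le {X : Type*} [MetricSpace X] {F : Set X} {s : ℝ} (hs : 0 ≤ s)
    (h : IsHomogeneous F s) : assouadDim F ≤ s :=
  sInf_le ⟨s, ⟨hs, h⟩, rfl⟩

theorem exists_isHomogeneous_of_assouadDim_lt {X : Type*} [MetricSpace X] {F : Set X} {a : EReal}
    (h : assouadDim F < a) : ∃ s : ℝ, 0 ≤ s ∧ IsHomogeneous F s ∧ (s : EReal) < a := by
  obtain ⟨_, ⟨s, ⟨hs, hFs⟩, rfl⟩, hlt⟩ := sInf_lt_iff.1 h
  exact ⟨s, hs, hFs, hlt⟩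

theorem statement2 {X Y : Type*} [MetricSpace X] [MetricSpace Y]
    (dZ : MetricSpace (X × Y)) (m₁ m₂ : ℝ) (hm₁ : 0 < m₁) (hm : m₁ ≤ m₂)
    (hd₁ : ∀ p q : X × Y,
      m₁ * max (dist p.1 q.1) (dist p.2 q.2) ≤ @dist _ dZ.toPseudoMetricSpace.toDist p q)
    (hd₂ : ∀ p q : X × Y,
      @dist _ dZ.toPseudoMetricSpace.toDist p q ≤ m₂ * max (dist p.1 q.1) (dist p.2 q.2))
    (F : Set X) (G : Set Y) :
    @assouadDim _ dZ (F ×ˢ G) ≤ assouadDim F + assouadDim G ∧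
      ∀ s t : ℝ, IsHomogeneous F s → IsHomogeneous G t →
        @IsHomogeneous _ dZ (F ×ˢ G) (s + t) := by
  have hhom : ∀ s t : ℝ, IsHomogeneous F s → IsHomogeneous G t →
      @IsHomogeneous _ dZ (F ×ˢ G) (s + t) := by
    intro s t hF hG
    have h := @IsHomogeneous.image2 X Y (X × Y) _ _ dZ Prod.mk m₁ m₂ hm₁ hm
      (fun x x' y y' => hd₁ (x, y) (x', y')) (fun x x' y y' => hd₂ (x, y) (x', y'))
      F G s t hF hG
    rwa [image2_mk_eq_prod] at h
  refine ⟨?_, hhom⟩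
  refine EReal.le_add_of_forall_gt
    (Or.inl ((EReal.bot_lt_zero.trans_le (assouadDim_nonneg F)).ne'))
    (Or.inr ((EReal.bot_lt_zero.trans_le (assouadDim_nonneg G)).ne')) ?_
  intro a ha b hb
  obtain ⟨s, hs, hF, hsa⟩ := exists_isHomogeneous_of_assouadDim_lt ha
  obtain ⟨t, ht, hG, htb⟩ := exists_isHomogeneous_of_assouadDim_lt hb
  exact (@assouadDim_le _ dZ _ _ (add_nonneg hs ht) (hhom s t hF hG)).trans
    ((EReal.coe_add s t).trans_le (add_le_add hsa.le htb.le))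

end Paper
end

section
/- Let (X,d_X) and (Y,d_Y) be metric spaces and endow X×Y with a metric d satisfying m₁ max(d_X,d_Y) ≤ d ≤ m₂ max(d_X,d_Y) for some constants 0 < m₁ ≤ m₂. If F ⊂ X and G ⊂ Y are equi-homogeneous, then the product F×G ⊂ X×Y is equi-homogeneous. -/
open Metric Set Filter
open scoped ENNReal NNReal

namespace Paper

theorem coverNum_mono_set {X : Type*} [MetricSpace X] {A B : Set X} (h : A ⊆ B) (r : ℝ) :
    coverNum A r ≤ coverNum B r :=
  le_iInf₂ fun s hs => iInf₂_le s (h.trans hs)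

theorem coverNum_anti_radius {X : Type*} [MetricSpace X] (A : Set X) {r r' : ℝ} (h : r ≤ r') :
    coverNum A r' ≤ coverNum A r :=
  le_iInf₂ fun s hs =>
    iInf₂_le s (hs.trans (iUnion₂_mono fun _ _ => closedBall_subset_closedBall h))

/-- A greedy choice of separated points either continues for `k` steps or ends in a cover. -/
theorem exists_separated_or_cover {X : Type*} [MetricSpace X] (A : Set X) {r : ℝ} (hr : 0 ≤ r)
    (k : ℕ) :
    ∃ s : Finset X, ↑s ⊆ A ∧ (s : Set X).Pairwise (fun x y => r < dist x y) ∧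
      (k ≤ s.card ∨ A ⊆ ⋃ x ∈ s, closedBall x r) := by
  classical
  induction k with
  | zero => exact ⟨∅, by simp⟩
  | succ k ih =>
    obtain ⟨s, hsA, hsep, hk⟩ := ih
    by_cases hc : A ⊆ ⋃ x ∈ s, closedBall x r
    · exact ⟨s, hsA, hsep, Or.inr hc⟩
    obtain ⟨x, hxA, hx⟩ := Set.not_subset.1 hc
    simp only [mem_iUnion, mem_closedBall, not_exists, not_le] at hx
    have hxs : x ∉ s := fun hxs => by
      have := hx x hxs
      rw [dist_self] at this
      exact this.not_ge hr
    refine ⟨insert x s, ?_, ?_, Or.inl ?_⟩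
    · simp [Set.insert_subset_iff, hxA, hsA]
    · rw [Finset.coe_insert]
      refine hsep.insert fun y hy _ => ⟨hx y hy, ?_⟩
      rw [dist_comm]
      exact hx y hy
    · rw [Finset.card_insert_of_notMem hxs]
      exact Nat.succ_le_succ (hk.resolve_right hc)

theorem exists_separated_of_lt_coverNum {X : Type*} [MetricSpace X] {A : Set X} {r : ℝ}
    (hr : 0 ≤ r) {a : ℝ≥0∞} (ha : a < coverNum A r) :
    ∃ s : Finset X, ↑s ⊆ A ∧ (s : Set X).Pairwise (fun x y => r < dist x y) ∧
      a ≤ (s.card : ℝ≥0∞) := by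
  obtain ⟨k, hk⟩ := ENNReal.exists_nat_gt ha.ne_top
  obtain ⟨s, hsA, hsep, h | h⟩ := exists_separated_or_cover A hr k
  · exact ⟨s, hsA, hsep, hk.le.trans (Nat.cast_le.2 h)⟩
  · exact ⟨s, hsA, hsep, ha.le.trans (iInf₂_le s h)⟩

theorem exists_cover_of_coverNum_lt {X : Type*} [MetricSpace X] {A : Set X} {r : ℝ} {a : ℝ≥0∞}
    (ha : coverNum A r < a) :
    ∃ s : Finset X, A ⊆ (⋃ x ∈ s, closedBall x r) ∧ (s.card : ℝ≥0∞) < a := by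
  simpa only [coverNum, iInf_lt_iff, exists_prop] using ha

theorem coverNum_ne_zero_s7 {X : Type*} [MetricSpace X] {A : Set X} (hA : A.Nonempty) (r : ℝ) :
    coverNum A r ≠ 0 := by
  refine (zero_lt_one.trans_le (le_iInf₂ fun s hs => ?_)).ne'
  obtain ⟨x, hx⟩ := hA
  obtain ⟨y, hy, -⟩ := mem_iUnion₂.1 (hs hx)
  exact_mod_cast Finset.card_pos.2 ⟨y, hy⟩

theorem coverNum_preimage_prod_le {X Y Z : Type*} [MetricSpace X] [MetricSpace Y] [MetricSpace Z]
    (e : Z ≃ X × Y) {m : ℝ} (hm : 0 ≤ m)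
    (hd : ∀ p q : Z, dist p q ≤ m * max (dist (e p).1 (e q).1) (dist (e p).2 (e q).2))
    (A : Set X) (B : Set Y) (r : ℝ) :
    coverNum (e ⁻¹' (A ×ˢ B)) (m * r) ≤ coverNum A r * coverNum B r := by
  rcases A.eq_empty_or_nonempty with rfl | hA
  · exact (iInf₂_le ∅ (by simp)).trans (by simp)
  rcases B.eq_empty_or_nonempty with rfl | hB
  · exact (iInf₂_le ∅ (by simp)).trans (by simp)
  refine ENNReal.le_mul_of_forall_lt (Or.inl (coverNum_ne_zero_s7 hA r))
    (Or.inr (coverNum_ne_zero_s7 hB r)) fun a ha b hb => ?_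
  obtain ⟨s, hs, hsa⟩ := exists_cover_of_coverNum_lt ha
  obtain ⟨t, ht, htb⟩ := exists_cover_of_coverNum_lt hb
  refine (iInf₂_le ((s ×ˢ t).map e.symm.toEmbedding) fun z hz => ?_).trans ?_
  · obtain ⟨x, hxs, hx⟩ := mem_iUnion₂.1 (hs hz.1)
    obtain ⟨y, hyt, hy⟩ := mem_iUnion₂.1 (ht hz.2)
    refine mem_iUnion₂.2 ⟨e.symm (x, y), Finset.mem_map_of_mem e.symm.toEmbedding
      (Finset.mk_mem_product hxs hyt), ?_⟩
    rw [mem_closedBall]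
    refine (hd _ _).trans (mul_le_mul_of_nonneg_left ?_ hm)
    rw [Equiv.apply_symm_apply]
    exact max_le hx hy
  · rw [Finset.card_map, Finset.card_product, Nat.cast_mul]
    exact mul_le_mul' hsa.le htb.le

theorem coverNum_mul_le_preimage_prod {X Y Z : Type*} [MetricSpace X] [MetricSpace Y]
    [MetricSpace Z] (e : Z ≃ X × Y) {m : ℝ} (hm : 0 < m)
    (hd : ∀ p q : Z, m * max (dist (e p).1 (e q).1) (dist (e p).2 (e q).2) ≤ dist p q)
    (A : Set X) (B : Set Y) {r : ℝ} (hr : 0 ≤ r) :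
    coverNum A r * coverNum B r ≤ coverNum (e ⁻¹' (A ×ˢ B)) (m * r / 2) := by
  refine ENNReal.mul_le_of_forall_lt fun a ha b hb => le_iInf₂ fun s hs => ?_
  obtain ⟨u, huA, husep, hau⟩ := exists_separated_of_lt_coverNum hr ha
  obtain ⟨v, hvB, hvsep, hbv⟩ := exists_separated_of_lt_coverNum hr hb
  refine (mul_le_mul' hau hbv).trans ?_
  rw [← Nat.cast_mul, ← Finset.card_product, Nat.cast_le]
  have hcov : ∀ w, ∃ z, w ∈ u ×ˢ v → z ∈ s ∧ dist (e.symm w) z ≤ m * r / 2 := fun w => by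
    by_cases hw : w ∉ u ×ˢ v
    · exact ⟨e.symm w, fun h => absurd h hw⟩
    rw [not_not, Finset.mem_product] at hw
    have := hs (show e.symm w ∈ e ⁻¹' (A ×ˢ B) by simpa using ⟨huA hw.1, hvB hw.2⟩)
    obtain ⟨z, hzs, hz⟩ := mem_iUnion₂.1 this
    exact ⟨z, fun _ => ⟨hzs, hz⟩⟩
  choose c hc using hcov
  refine Finset.card_le_card_of_injOn c (fun w hw => (hc w hw).1) fun w hw w' hw' hww' => ?_
  have h1 := (hc w hw).2
  have h2 := (hc w' hw').2
  rw [← hww', dist_comm] at h2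
  have h3 := (hd (e.symm w) (e.symm w')).trans
    ((dist_triangle _ (c w) _).trans (add_le_add h1 h2))
  simp only [Equiv.apply_symm_apply, add_halves] at h3
  have h4 := max_le_iff.1 (le_of_mul_le_mul_left h3 hm)
  simp only [Finset.coe_product, Set.mem_prod] at hw hw'
  exact Prod.ext (husep.eq hw.1 hw'.1 h4.1.not_gt) (hvsep.eq hw.2 hw'.2 h4.2.not_gt)

theorem EquiHomogeneous.preimage_prod {X Y Z : Type*} [MetricSpace X] [MetricSpace Y]
    [MetricSpace Z] (e : Z ≃ X × Y) {m₁ m₂ : ℝ} (hm₁ : 0 < m₁) (hm : m₁ ≤ m₂)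
    (hd₁ : ∀ p q : Z, m₁ * max (dist (e p).1 (e q).1) (dist (e p).2 (e q).2) ≤ dist p q)
    (hd₂ : ∀ p q : Z, dist p q ≤ m₂ * max (dist (e p).1 (e q).1) (dist (e p).2 (e q).2))
    {F : Set X} {G : Set Y} (hF : EquiHomogeneous F) (hG : EquiHomogeneous G) :
    EquiHomogeneous (e ⁻¹' (F ×ˢ G)) := by
  intro δ₀ hδ₀
  have hm₂ : 0 < m₂ := hm₁.trans_le hm
  obtain ⟨M, hM, a, b, ha, hb, hF⟩ := hF (δ₀ / m₁) (by positivity)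
  obtain ⟨M', hM', a', b', ha', hb', hG⟩ := hG (δ₀ / m₁) (by positivity)
  have ha₀ : 0 < max a a' := lt_max_of_lt_left ha
  have hb₀ : 0 < min b b' := lt_min hb hb'
  refine ⟨M * M', one_le_mul hM hM', m₂ * (max a a' / m₁), m₁ * (min b b' / m₂) / 2,
    by positivity, by positivity, fun δ ρ hρ hρδ hδ => ?_⟩
  have hδ' : 0 < δ := hρ.trans hρδ
  have hρ' : 0 < ρ / m₂ := by positivity
  have hlt : ρ / m₂ < δ / m₁ := div_lt_div₀ hρδ hm hδ'.le hm₁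
  have hle : δ / m₁ ≤ δ₀ / m₁ := by gcongr
  replace hF := hF _ _ hρ' hlt hle
  replace hG := hG _ _ hρ' hlt hle
  refine iSup₂_le fun z hz => ?_
  have upper : coverNum (closedBall z δ ∩ e ⁻¹' (F ×ˢ G)) ρ ≤
      coverNum (closedBall (e z).1 (δ / m₁) ∩ F) (ρ / m₂) *
        coverNum (closedBall (e z).2 (δ / m₁) ∩ G) (ρ / m₂) := by
    have h := coverNum_preimage_prod_le e hm₂.le hd₂ (closedBall (e z).1 (δ / m₁) ∩ F)
      (closedBall (e z).2 (δ / m₁) ∩ G) (ρ / m₂)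
    rw [mul_div_cancel₀ _ hm₂.ne'] at h
    refine (coverNum_mono_set (fun w hw => ?_) ρ).trans h
    have hmax : max (dist (e w).1 (e z).1) (dist (e w).2 (e z).2) ≤ δ / m₁ := by
      rw [le_div_iff₀' hm₁]
      exact (hd₁ w z).trans hw.1
    exact ⟨⟨(le_max_left _ _).trans hmax, hw.2.1⟩, ⟨(le_max_right _ _).trans hmax, hw.2.2⟩⟩
  have lower : (⨅ x ∈ F, coverNum (closedBall x (a * (δ / m₁)) ∩ F) (b * (ρ / m₂))) *
      (⨅ y ∈ G, coverNum (closedBall y (a' * (δ / m₁)) ∩ G) (b' * (ρ / m₂))) ≤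
      ⨅ w ∈ e ⁻¹' (F ×ˢ G), coverNum
        (closedBall w (m₂ * (max a a' / m₁) * δ) ∩ e ⁻¹' (F ×ˢ G))
        (m₁ * (min b b' / m₂) / 2 * ρ) := by
    refine le_iInf₂ fun w hw => (mul_le_mul' (iInf₂_le (e w).1 hw.1)
      (iInf₂_le (e w).2 hw.2)).trans ?_
    refine (mul_le_mul' (coverNum_anti_radius _ (r := min b b' * (ρ / m₂)) ?_)
      (coverNum_anti_radius _ (r := min b b' * (ρ / m₂)) ?_)).trans
      ((coverNum_mul_le_preimage_prod e hm₁ hd₁ _ _ (by positivity)).trans ?_)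
    · gcongr
      exact min_le_left _ _
    · gcongr
      exact min_le_right _ _
    · rw [show m₁ * (min b b' / m₂) / 2 * ρ = m₁ * (min b b' * (ρ / m₂)) / 2 by ring]
      refine coverNum_mono_set (fun v hv => ?_) _
      refine ⟨mem_closedBall.2 ?_, hv.1.2, hv.2.2⟩
      have h1 : dist (e v).1 (e w).1 ≤ max a a' * (δ / m₁) := by
        refine (mem_closedBall.1 hv.1.1).trans ?_
        gcongr
        exact le_max_left _ _
      have h2 : dist (e v).2 (e w).2 ≤ max a a' * (δ / m₁) := by
        refine (mem_closedBall.1 hv.2.1).trans ?_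
        gcongr
        exact le_max_right _ _
      calc dist v w ≤ m₂ * max (dist (e v).1 (e w).1) (dist (e v).2 (e w).2) := hd₂ v w
        _ ≤ m₂ * (max a a' * (δ / m₁)) := by
          gcongr
          exact max_le h1 h2
        _ = m₂ * (max a a' / m₁) * δ := by ring
  calc coverNum (closedBall z δ ∩ e ⁻¹' (F ×ˢ G)) ρ
      ≤ _ := upper
    _ ≤ _ := mul_le_mul' ((le_iSup₂ (f := fun x _ => coverNum (closedBall x (δ / m₁) ∩ F) (ρ / m₂))
          (e z).1 hz.1).trans hF)
        ((le_iSup₂ (f := fun y _ => coverNum (closedBall y (δ / m₁) ∩ G) (ρ / m₂))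
          (e z).2 hz.2).trans hG)
    _ = _ := mul_mul_mul_comm _ _ _ _
    _ ≤ _ := by
      rw [ENNReal.coe_mul]
      exact mul_le_mul_right lower _

theorem statement7 {X Y : Type*} [MetricSpace X] [MetricSpace Y]
    (dZ : MetricSpace (X × Y)) (m₁ m₂ : ℝ) (hm₁ : 0 < m₁) (hm : m₁ ≤ m₂)
    (hd₁ : ∀ p q : X × Y,
      m₁ * max (dist p.1 q.1) (dist p.2 q.2) ≤ @dist _ dZ.toPseudoMetricSpace.toDist p q)
    (hd₂ : ∀ p q : X × Y,
      @dist _ dZ.toPseudoMetricSpace.toDist p q ≤ m₂ * max (dist p.1 q.1) (dist p.2 q.2))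
    (F : Set X) (G : Set Y) (hF : EquiHomogeneous F) (hG : EquiHomogeneous G) :
    @EquiHomogeneous _ dZ (F ×ˢ G) := by
  exact @EquiHomogeneous.preimage_prod X Y (X × Y) _ _ dZ (Equiv.refl _) m₁ m₂ hm₁ hm hd₁ hd₂
    F G hF hG

end Paper
end

section
/- Let C be the generalised Cantor set generated by a sequence (λ_i) with λ_i ∈ (0,1/2), and let L_n = λ_1⋯λ_n (with L_0 = 1). Then for every n ≥ 1 and every δ with L_n ≤ δ < L_{n−1}, the minimum number of sets of diameter at most δ needed to cover C satisfies 2^{n−1} ≤ D(C,δ) ≤ 2^n. -/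
open Metric Set Filter
open scoped ENNReal NNReal

namespace Paper

theorem cantorLen_succ (lam : ℕ → ℝ) (n : ℕ) :
    cantorLen lam (n + 1) = cantorLen lam n * lam n :=
  Finset.prod_range_succ _ _

section Offset

variable {lam : ℕ → ℝ}

theorem cantorLen_pos (hlam : ∀ i, lam i ∈ Set.Ioo (0 : ℝ) (1 / 2)) (n : ℕ) :
    0 < cantorLen lam n :=
  Finset.prod_pos fun i _ => (hlam i).1

theorem two_mul_cantorLen_succ_lt (hlam : ∀ i, lam i ∈ Set.Ioo (0 : ℝ) (1 / 2)) (n : ℕ) :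
    2 * cantorLen lam (n + 1) < cantorLen lam n := by
  rw [cantorLen_succ]
  nlinarith [cantorLen_pos hlam n, (hlam n).2]

/-- The left endpoint of the level `n` interval of the Cantor construction with address `ε`. -/
noncomputable def cantorOffset (lam : ℕ → ℝ) (ε : ℕ → Bool) (n : ℕ) : ℝ :=
  ∑ i ∈ Finset.range n, if ε i then cantorLen lam i - cantorLen lam (i + 1) else 0

theorem cantorOffset_succ (ε : ℕ → Bool) (n : ℕ) :
    cantorOffset lam ε (n + 1) =
      cantorOffset lam ε n + if ε n then cantorLen lam n - cantorLen lam (n + 1) else 0 :=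
  Finset.sum_range_succ _ _

theorem cantorOffset_congr {ε ε' : ℕ → Bool} {n : ℕ} (h : ∀ i < n, ε i = ε' i) :
    cantorOffset lam ε n = cantorOffset lam ε' n :=
  Finset.sum_congr rfl fun i hi => by rw [h i (Finset.mem_range.1 hi)]

theorem cantorOffset_monotone (hlam : ∀ i, lam i ∈ Set.Ioo (0 : ℝ) (1 / 2)) (ε : ℕ → Bool) :
    Monotone (cantorOffset lam ε) :=
  monotone_nat_of_le_succ fun n => by
    have h₁ := two_mul_cantorLen_succ_lt hlam n
    have h₂ := cantorLen_pos hlam (n + 1)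
    rw [cantorOffset_succ]
    split_ifs <;> linarith

theorem cantorOffset_add_cantorLen_antitone (hlam : ∀ i, lam i ∈ Set.Ioo (0 : ℝ) (1 / 2))
    (ε : ℕ → Bool) : Antitone fun n => cantorOffset lam ε n + cantorLen lam n :=
  antitone_nat_of_succ_le fun n => by
    have h₁ := two_mul_cantorLen_succ_lt hlam n
    have h₂ := cantorLen_pos hlam (n + 1)
    simp only [cantorOffset_succ]
    split_ifs <;> linarith

theorem cantorOffset_mem_cantorSet (hlam : ∀ i, lam i ∈ Set.Ioo (0 : ℝ) (1 / 2))
    {ε : ℕ → Bool} {m : ℕ} (hε : ∀ i, m ≤ i → ε i = false) :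
    cantorOffset lam ε m ∈ cantorSet lam := by
  refine Set.mem_iInter.2 fun N => Set.mem_iUnion.2 ⟨ε, ?_⟩
  change cantorOffset lam ε N ≤ cantorOffset lam ε m ∧
    cantorOffset lam ε m ≤ cantorOffset lam ε N + cantorLen lam N
  have hN := cantorLen_pos hlam N
  rcases le_total N m with h | h
  · have h' := cantorOffset_add_cantorLen_antitone hlam ε h
    have hm := cantorLen_pos hlam m
    exact ⟨cantorOffset_monotone hlam ε h, by dsimp only at h'; linarith⟩
  · have heq : cantorOffset lam ε N = cantorOffset lam ε m := by
      induction N, h using Nat.le_induction with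
      | base => rfl
      | succ k hk ih => simp [cantorOffset_succ, hε k hk, ih (cantorLen_pos hlam k)]
    exact ⟨heq.le, by linarith⟩

theorem cantorLen_lt_abs_cantorOffset_sub (hlam : ∀ i, lam i ∈ Set.Ioo (0 : ℝ) (1 / 2))
    {ε ε' : ℕ → Bool} {m : ℕ} (h : ∃ i < m, ε i ≠ ε' i) :
    cantorLen lam m < |cantorOffset lam ε m - cantorOffset lam ε' m| := by
  induction m with
  | zero => simp at h
  | succ m ih =>
    have h₁ := two_mul_cantorLen_succ_lt hlam m
    have h₂ := cantorLen_pos hlam (m + 1)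
    rw [cantorOffset_succ, cantorOffset_succ]
    by_cases hm : ∃ i < m, ε i ≠ ε' i
    · have := ih hm
      rw [lt_abs] at this ⊢
      rcases this with h | h
      · left; split_ifs <;> linarith
      · right; split_ifs <;> linarith
    · push Not at hm
      obtain ⟨i, hi, hne⟩ := h
      obtain rfl : i = m := by
        by_contra hi'
        exact hne (hm i (by omega))
      rw [cantorOffset_congr hm, lt_abs]
      cases hi₁ : ε i <;> cases hi₂ : ε' i <;> simp_all <;>
        first | (left; linarith) | (right; linarith)

end Offset

theorem two_pow_le_diamCoverNum_cantorSet {lam : ℕ → ℝ}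
    (hlam : ∀ i, lam i ∈ Set.Ioo (0 : ℝ) (1 / 2)) {m : ℕ} {δ : ℝ} (hδ : δ < cantorLen lam m) :
    (2 : ℝ≥0∞) ^ m ≤ diamCoverNum (cantorSet lam) δ := by
  refine le_iInf fun U => le_iInf fun hU => le_iInf fun hdiam => ?_
  let p : Finset ℕ → ℝ := fun s => cantorOffset lam (fun i => decide (i ∈ s)) m
  have hp : ∀ s ∈ (Finset.range m).powerset, ∃ A ∈ U, p s ∈ A := fun s hs =>
    hU (cantorOffset_mem_cantorSet hlam fun i hi => decide_eq_false fun his => by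
      have := Finset.mem_range.1 (Finset.mem_powerset.1 hs his)
      omega)
  choose! f hfU hpf using hp
  have hinj : Set.InjOn f (Finset.range m).powerset := by
    intro s hs t ht hst
    by_contra hne
    have hex : ∃ i < m, decide (i ∈ s) ≠ decide (i ∈ t) := by
      by_contra! hcon
      refine hne (Finset.ext fun i => ?_)
      by_cases hi : i < m
      · simpa using hcon i hi
      · exact iff_of_false
          (fun h => hi (Finset.mem_range.1 (Finset.mem_powerset.1 hs h)))
          (fun h => hi (Finset.mem_range.1 (Finset.mem_powerset.1 ht h)))
    have hlt : cantorLen lam m < |p s - p t| := cantorLen_lt_abs_cantorOffset_sub hlam hex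
    have hle : edist (p s) (p t) ≤ ENNReal.ofReal δ :=
      (Metric.edist_le_ediam_of_mem (hpf s hs) (hst ▸ hpf t ht)).trans (hdiam _ (hfU s hs))
    rw [edist_dist, Real.dist_eq, ENNReal.ofReal_le_ofReal_iff'] at hle
    have := cantorLen_pos hlam m
    rcases hle with hle | hle <;> linarith
  have hcard := Finset.card_le_card_of_injOn f hfU hinj
  rw [Finset.card_powerset, Finset.card_range] at hcard
  exact_mod_cast hcard

theorem diamCoverNum_cantorSet_le_two_pow {lam : ℕ → ℝ} {n : ℕ} {δ : ℝ}
    (hδ : cantorLen lam n ≤ δ) : diamCoverNum (cantorSet lam) δ ≤ (2 : ℝ≥0∞) ^ n := by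
  classical
  let I : (ℕ → Bool) → Set ℝ := fun ε =>
    Set.Icc (cantorOffset lam ε n) (cantorOffset lam ε n + cantorLen lam n)
  let U : Finset (Set ℝ) := (Finset.range n).powerset.image fun s => I fun i => decide (i ∈ s)
  have hcover : cantorSet lam ⊆ ⋃₀ ↑U := by
    intro x hx
    obtain ⟨ε, hε⟩ := Set.mem_iUnion.1 (Set.mem_iInter.1 hx n)
    refine ⟨I ε, ?_, hε⟩
    refine Finset.mem_coe.2 (Finset.mem_image.2
      ⟨(Finset.range n).filter fun i => ε i, by simp, ?_⟩)
    have heq : cantorOffset lam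
        (fun i => decide (i ∈ (Finset.range n).filter fun i => ε i)) n =
        cantorOffset lam ε n :=
      cantorOffset_congr fun i hi => by simp [hi]
    simp only [I, heq]
  have hdiam : ∀ A ∈ U, Metric.ediam A ≤ ENNReal.ofReal δ := by
    intro A hA
    obtain ⟨s, -, rfl⟩ := Finset.mem_image.1 hA
    refine (Real.ediam_Icc _ _).trans_le (ENNReal.ofReal_le_ofReal ?_)
    simpa using hδ
  refine (iInf_le_of_le U (iInf_le_of_le hcover (iInf_le _ hdiam))).trans ?_
  have hcard : U.card ≤ 2 ^ n := Finset.card_image_le.trans (by simp)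
  exact_mod_cast hcard

theorem statement8 (lam : ℕ → ℝ) (hlam : ∀ i, lam i ∈ Set.Ioo (0 : ℝ) (1 / 2))
    (n : ℕ) (hn : 1 ≤ n) (δ : ℝ)
    (h₁ : cantorLen lam n ≤ δ) (h₂ : δ < cantorLen lam (n - 1)) :
    ((2 : ℝ≥0∞) ^ (n - 1) ≤ diamCoverNum (cantorSet lam) δ) ∧
      diamCoverNum (cantorSet lam) δ ≤ (2 : ℝ≥0∞) ^ n :=
  ⟨two_pow_le_diamCoverNum_cantorSet hlam h₂, diamCoverNum_cantorSet_le_two_pow h₁⟩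

end Paper
end
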